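/- Let ℬ be a Markushevich basis of 𝕏 and w a weight. The following are equivalent: (i) ℬ is truncation quasi-greedy and w-superdemocratic; (ii) ℬ is truncation quasi-greedy and w-democratic; (iii) for every 0 < s ≤ 1, ℬ is s-w-almost semi-greedy; (iv) there is some 0 < s ≤ 1 such that ℬ is s-w-almost semi-greedy; (v) for each 0 < s ≤ 1 there is a constant C(s) > 0 such that ‖x‖ ≤ C(s)‖x − P_B(x)‖ for every x ∈ 𝕏 and every finite B ⊂ ℕ for which there exist m ∈ ℕ and A ∈ 𝒢(x,m,s) with A ∩ B = ∅ and w(B) ≤ w(A). -/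

import Mathlib

open scoped BigOperators ENNReal
open Filter

noncomputable section

namespace GreedyPaper

variable {𝕜 : Type*} [RCLike 𝕜] {X : Type*} [NormedAddCommGroup X] [NormedSpace 𝕜 X]

/-- Support of `x` with respect to the coordinate functionals `f`. -/
def msupp (f : ℕ → X →L[𝕜] 𝕜) (x : X) : Set ℕ := {i | f i x ≠ 0}

/-- Projection onto a finite set of coordinates. -/
def proj (e : ℕ → X) (f : ℕ → X →L[𝕜] 𝕜) (A : Finset ℕ) (x : X) : X :=
  ∑ i ∈ A, f i x • e i

/-- `A` is an `m`-`t`-greedy set for `x`: `|A| = m` and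
`min_{j ∈ A} |f j x| ≥ t · sup_{k ∉ A} |f k x|`. -/
def GreedySet (f : ℕ → X →L[𝕜] 𝕜) (x : X) (m : ℕ) (t : ℝ) (A : Finset ℕ) : Prop :=
  A.card = m ∧ ∀ j ∈ A, ∀ k ∉ A, t * ‖f k x‖ ≤ ‖f j x‖

/-- `w`-measure of a set of indices, with value in `ℝ≥0∞` (possibly infinite). -/
def wsum (w : ℕ → ℝ) (S : Set ℕ) : ℝ≥0∞ := ∑' i : S, ENNReal.ofReal (w i)

/-- Sign of a scalar: `sgn 0 = 1` and `sgn t * t = |t|`. -/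
def sgn (t : 𝕜) : 𝕜 := if t = 0 then 1 else (‖t‖ : 𝕜) / t

/-- A Markushevich basis (with the boundedness assumptions of the paper):
biorthogonality, dense span, totality of the coordinate functionals, and boundedness
of both the basis vectors and the coordinate functionals. -/
structure IsMarkushevichBasis (e : ℕ → X) (f : ℕ → X →L[𝕜] 𝕜) : Prop where
  biorth : ∀ i j, f i (e j) = if i = j then 1 else 0
  dense_span : Dense ((Submodule.span 𝕜 (Set.range e) : Submodule 𝕜 X) : Set X)
  total : ∀ x : X, (∀ i, f i x = 0) → x = 0
  bddE : BddAbove (Set.range fun i => ‖e i‖)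
  bddF : BddAbove (Set.range fun i => ‖f i‖)

/-- `ℬ` is `C`-`s`-`w`-semi-greedy: for every `x` and `m` there are an `m`-`s`-greedy set `A`
and `y` supported in `A` with `‖x - y‖ ≤ C · inf {‖x - z‖ : supp z finite, w(supp z) ≤ w(A)}`. -/
def SemiGreedy (e : ℕ → X) (f : ℕ → X →L[𝕜] 𝕜) (w : ℕ → ℝ) (C s : ℝ) : Prop :=
  ∀ (x : X) (m : ℕ), ∃ A : Finset ℕ, GreedySet f x m s A ∧
    ∃ y : X, msupp f y ⊆ (A : Set ℕ) ∧
      ∀ z : X, (msupp f z).Finite → wsum w (msupp f z) ≤ wsum w (A : Set ℕ) →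
        ‖x - y‖ ≤ C * ‖x - z‖

/-- `ℬ` is `C`-`s`-`w`-almost semi-greedy. -/
def AlmostSemiGreedy (e : ℕ → X) (f : ℕ → X →L[𝕜] 𝕜) (w : ℕ → ℝ) (C s : ℝ) : Prop :=
  ∀ (x : X) (m : ℕ), ∃ A : Finset ℕ, GreedySet f x m s A ∧
    ∃ y : X, msupp f y ⊆ (A : Set ℕ) ∧
      ∀ B : Finset ℕ, wsum w (B : Set ℕ) ≤ wsum w (A : Set ℕ) →
        ‖x - y‖ ≤ C * ‖x - proj e f B x‖

/-- `ℬ` is `C`-`w`-almost greedy. -/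
def AlmostGreedy (e : ℕ → X) (f : ℕ → X →L[𝕜] 𝕜) (w : ℕ → ℝ) (C : ℝ) : Prop :=
  ∀ (x : X) (m : ℕ) (A : Finset ℕ), GreedySet f x m 1 A →
    ∀ B : Finset ℕ, wsum w (B : Set ℕ) ≤ wsum w (A : Set ℕ) →
      ‖x - proj e f A x‖ ≤ C * ‖x - proj e f B x‖

/-- `ℬ` is `C`-`w`-disjoint almost greedy. -/
def DisjointAlmostGreedy (e : ℕ → X) (f : ℕ → X →L[𝕜] 𝕜) (w : ℕ → ℝ) (C : ℝ) : Prop :=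
  ∀ (x : X) (m : ℕ) (A : Finset ℕ), GreedySet f x m 1 A →
    ∀ B : Finset ℕ, wsum w (B : Set ℕ) ≤ wsum w (A : Set ℕ) → Disjoint B A →
      ‖x - proj e f A x‖ ≤ C * ‖x - proj e f B x‖

/-- `ℬ` is `C`-`s`-`w`-almost greedy in the weak sense. -/
def WeakAlmostGreedy (e : ℕ → X) (f : ℕ → X →L[𝕜] 𝕜) (w : ℕ → ℝ) (C s : ℝ) : Prop :=
  ∀ (x : X) (m : ℕ), ∃ A : Finset ℕ, GreedySet f x m s A ∧
    ∀ B : Finset ℕ, wsum w (B : Set ℕ) ≤ wsum w (A : Set ℕ) →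
      ‖x - proj e f A x‖ ≤ C * ‖x - proj e f B x‖

/-- `ℬ` is `C`-`w`-superdemocratic. -/
def SuperDemocratic (e : ℕ → X) (f : ℕ → X →L[𝕜] 𝕜) (w : ℕ → ℝ) (C : ℝ) : Prop :=
  ∀ (A B : Finset ℕ) (ε ε' : ℕ → 𝕜), (∀ i ∈ A, ‖ε i‖ = 1) → (∀ i ∈ B, ‖ε' i‖ = 1) →
    wsum w (A : Set ℕ) ≤ wsum w (B : Set ℕ) →
      ‖∑ i ∈ A, ε i • e i‖ ≤ C * ‖∑ i ∈ B, ε' i • e i‖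

/-- `ℬ` is `C`-`w`-democratic. -/
def Democratic (e : ℕ → X) (f : ℕ → X →L[𝕜] 𝕜) (w : ℕ → ℝ) (C : ℝ) : Prop :=
  ∀ A B : Finset ℕ, wsum w (A : Set ℕ) ≤ wsum w (B : Set ℕ) →
    ‖∑ i ∈ A, e i‖ ≤ C * ‖∑ i ∈ B, e i‖

/-- `ℬ` is `C`-truncation quasi-greedy. -/
def TruncationQuasiGreedy (e : ℕ → X) (f : ℕ → X →L[𝕜] 𝕜) (C : ℝ) : Prop :=
  ∀ (x : X) (m : ℕ) (A : Finset ℕ) (hA : A.Nonempty), GreedySet f x m 1 A →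
    (A.inf' hA fun i => ‖f i x‖) * ‖∑ i ∈ A, sgn (f i x) • e i‖ ≤ C * ‖x‖

/-- `ℬ` has the `C`-`w`-Property (A). -/
def PropertyA (e : ℕ → X) (f : ℕ → X →L[𝕜] 𝕜) (w : ℕ → ℝ) (C : ℝ) : Prop :=
  ∀ x : X, (∀ i, ‖f i x‖ ≤ 1) →
    ∀ A B : Finset ℕ, wsum w (A : Set ℕ) ≤ wsum w (B : Set ℕ) → Disjoint A B →
      (∀ i ∈ A ∪ B, f i x = 0) →
      ∀ ε ε' : ℕ → 𝕜, (∀ i ∈ A, ‖ε i‖ = 1) → (∀ i ∈ B, ‖ε' i‖ = 1) →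
        ‖x + ∑ i ∈ A, ε i • e i‖ ≤ C * ‖x + ∑ i ∈ B, ε' i • e i‖

/-- The finite dimensional separation property (FDSP) with constant `M`. -/
def FDSP (e : ℕ → X) (M : ℝ) : Prop :=
  ∀ Z : Submodule 𝕜 X, IsClosed (Z : Set X) → TopologicalSpace.IsSeparable (Z : Set X) →
    ∀ ε : ℝ, 0 < ε → ∃ k : ℕ → ℕ, StrictMono k ∧
      (∀ (a : ℕ → 𝕜) (n l : ℕ), n ≤ l →
        ‖∑ j ∈ Finset.range (n + 1), a j • e (k j)‖ ≤
          (M + ε) * ‖∑ j ∈ Finset.range (l + 1), a j • e (k j)‖) ∧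
      (∀ F : Submodule 𝕜 X, F ≤ Z → FiniteDimensional 𝕜 F →
        ∃ N : ℕ, ∀ x ∈ F,
          ∀ z ∈ closure ((Submodule.span 𝕜 {v : X | ∃ n, N < n ∧ v = e (k n)} :
              Submodule 𝕜 X) : Set X),
            ‖x‖ ≤ (M + ε) * ‖x + z‖)

/-- `v` is a block basis of `e`. -/
def IsBlockBasis (e v : ℕ → X) : Prop :=
  ∃ (b : ℕ → 𝕜) (n m : ℕ → ℕ), (∀ i, n i ≤ m i) ∧ (∀ i, m i < n (i + 1)) ∧
    (∀ i, v i = ∑ k ∈ Finset.Icc (n i) (m i), b k • e k) ∧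
    (∀ i, ∃ k ∈ Finset.Icc (n i) (m i), b k ≠ 0)

section Weights

variable {w : ℕ → ℝ}

lemma wsum_coe_finset (hw : ∀ i, 0 < w i) (A : Finset ℕ) :
    wsum w (A : Set ℕ) = ENNReal.ofReal (∑ i ∈ A, w i) := by
  rw [ENNReal.ofReal_sum_of_nonneg fun i _ => (hw i).le]
  exact Finset.tsum_subtype A fun i => ENNReal.ofReal (w i)

lemma wsum_le_wsum_iff (hw : ∀ i, 0 < w i) (A B : Finset ℕ) :
    wsum w (A : Set ℕ) ≤ wsum w (B : Set ℕ) ↔ ∑ i ∈ A, w i ≤ ∑ i ∈ B, w i := by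
  rw [wsum_coe_finset hw, wsum_coe_finset hw,
    ENNReal.ofReal_le_ofReal_iff (Finset.sum_nonneg fun i _ => (hw i).le)]

lemma eq_empty_of_sum_weight_nonpos (hw : ∀ i, 0 < w i) {A : Finset ℕ}
    (hA : ∑ i ∈ A, w i ≤ 0) : A = ∅ := by
  by_contra h
  exact absurd (Finset.sum_pos (fun i _ => hw i) (Finset.nonempty_iff_ne_empty.2 h)) hA.not_gt

/-- A finite set of weight above `t ≥ 0` contains a subset of weight at most `t` whose weight
exceeds `t` after adding one more element. -/
lemma exists_subset_weight_crossing {t : ℝ} (ht : 0 ≤ t) (A : Finset ℕ)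
    (hA : t < ∑ i ∈ A, w i) :
    ∃ E n, insert n E ⊆ A ∧ n ∉ E ∧ ∑ i ∈ E, w i ≤ t ∧ t < ∑ i ∈ insert n E, w i := by
  induction A using Finset.induction_on with
  | empty => simp at hA; linarith
  | insert a A ha ih =>
    by_cases h : t < ∑ i ∈ A, w i
    · obtain ⟨E, n, hE, hn, h1, h2⟩ := ih h
      exact ⟨E, n, hE.trans (Finset.subset_insert _ _), hn, h1, h2⟩
    · exact ⟨A, a, subset_rfl, ha, not_lt.1 h, hA⟩

/-- The finite subsets of `H` have bounded weight. -/
def LightSet (w : ℕ → ℝ) (H : Set ℕ) : Prop :=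
  ∃ T : ℝ, ∀ A : Finset ℕ, (A : Set ℕ) ⊆ H → ∑ i ∈ A, w i ≤ T

lemma LightSet.union {H₁ H₂ : Set ℕ} (h₁ : LightSet w H₁)
    (h₂ : LightSet w H₂) : LightSet w (H₁ ∪ H₂) := by
  classical
  obtain ⟨T₁, h₁⟩ := h₁
  obtain ⟨T₂, h₂⟩ := h₂
  refine ⟨T₁ + T₂, fun A hA => ?_⟩
  rw [← Finset.sum_filter_add_sum_filter_not A (· ∈ H₁)]
  refine add_le_add (h₁ _ fun i hi => ?_) (h₂ _ fun i hi => ?_)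
  · simp at hi; exact hi.2
  · simp at hi; exact (hA hi.1).resolve_left hi.2

lemma LightSet.mono {H₁ H₂ : Set ℕ} (h : H₁ ⊆ H₂) (h₂ : LightSet w H₂) : LightSet w H₁ :=
  h₂.imp fun _ hT A hA => hT A (hA.trans h)

lemma LightSet.biUnion {ι : Type*} {S : Set ι} (hS : S.Finite)
    {H : ι → Set ℕ} (h : ∀ l ∈ S, LightSet w (H l)) : LightSet w (⋃ l ∈ S, H l) := by
  induction S, hS using Set.Finite.induction_on with
  | empty =>
    refine ⟨0, fun A hA => ?_⟩
    have : A = ∅ := by simpa using hA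
    simp [this]
  | insert _ _ ih =>
    rw [Set.biUnion_insert]
    exact (h _ (Set.mem_insert _ _)).union (ih fun l hl => h l (Set.mem_insert_of_mem _ hl))

lemma exists_disjoint_heavy_of_not_light {H : Set ℕ} (hw : ∀ i, 0 < w i) (hH : ¬ LightSet w H)
    (Q : Finset ℕ) (T : ℝ) :
    ∃ A : Finset ℕ, (A : Set ℕ) ⊆ H ∧ Disjoint A Q ∧ T < ∑ i ∈ A, w i := by
  simp only [LightSet, not_exists, not_forall, not_le] at hH
  obtain ⟨A, hA, hT⟩ := hH (T + ∑ i ∈ Q, w i)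
  refine ⟨A \ Q, fun i hi => hA (by simp at hi ⊢; exact hi.1), Finset.sdiff_disjoint, ?_⟩
  have h1 := Finset.sum_inter_add_sum_sdiff A Q w
  have h2 : ∑ i ∈ A ∩ Q, w i ≤ ∑ i ∈ Q, w i :=
    Finset.sum_le_sum_of_subset_of_nonneg Finset.inter_subset_right fun i _ _ => (hw i).le
  linarith

/-- A subadditive quantity that is at most `M` on singletons and on sets of weight at most `b`
grows at most linearly with the weight. -/
lemma linear_bound_of_subadditive (hw : ∀ i, 0 < w i) {R : Finset ℕ → ℝ → Prop} {S : Set ℕ}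
    {M b : ℝ} (hb : 0 < b) (hM : 0 ≤ M)
    (hadd : ∀ A A' r r', Disjoint A A' → R A r → R A' r' → R (A ∪ A') (r + r'))
    (hmono : ∀ A r r', r ≤ r' → R A r → R A r')
    (hsmall : ∀ A : Finset ℕ, (A : Set ℕ) ⊆ S → ∑ i ∈ A, w i ≤ b → R A M)
    (hsingle : ∀ i ∈ S, R {i} M) (A : Finset ℕ) (hA : (A : Set ℕ) ⊆ S) :
    R A (M * (1 + 2 * (∑ i ∈ A, w i) / b)) := by
  induction A using Finset.strongInduction with
  | H A ih =>
    by_cases h : ∑ i ∈ A, w i ≤ b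
    · refine hmono _ _ _ ?_ (hsmall A hA h)
      have : 0 ≤ 2 * (∑ i ∈ A, w i) / b :=
        div_nonneg (mul_nonneg (by norm_num) (Finset.sum_nonneg fun i _ => (hw i).le)) hb.le
      nlinarith
    · obtain ⟨E, n, hE, hn, h1, h2⟩ := exists_subset_weight_crossing hb.le A (not_le.1 h)
      have hnA : n ∈ A := hE (Finset.mem_insert_self _ _)
      have hEA : E ⊆ A := (Finset.subset_insert _ _).trans hE
      have hr := ih (A \ insert n E)
        (Finset.sdiff_ssubset hE ⟨n, Finset.mem_insert_self _ _⟩)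
        (fun i hi => hA (by simp at hi ⊢; exact hi.1))
      have hE' := hadd E {n} M M (by simpa using hn)
        (hsmall E (fun i hi => hA (hEA hi)) h1) (hsingle n (hA hnA))
      have hEn : E ∪ {n} = insert n E := by ext; simp
      rw [hEn] at hE'
      have hfin := hadd _ _ _ _ Finset.disjoint_sdiff hE' hr
      rw [Finset.union_sdiff_of_subset hE] at hfin
      refine hmono _ _ _ ?_ hfin
      have hs := Finset.sum_sdiff (f := w) hE
      have h3 : ∑ i ∈ A \ insert n E, w i ≤ ∑ i ∈ A, w i - b := by linarith
      have h4 : 2 * (∑ i ∈ A \ insert n E, w i) / b ≤ 2 * (∑ i ∈ A, w i) / b - 2 := by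
        rw [div_le_iff₀ hb, sub_mul, div_mul_cancel₀ _ hb.ne']
        linarith
      nlinarith

end Weights

section Coordinates

variable {e : ℕ → X} {f : ℕ → X →L[𝕜] 𝕜}

lemma norm_sgn (t : 𝕜) : ‖sgn t‖ = 1 := by
  unfold sgn
  split_ifs with h
  · simp
  · rw [norm_div, RCLike.norm_ofReal, abs_norm, div_self (norm_ne_zero_iff.2 h)]

lemma sgn_mul_self (t : 𝕜) : sgn t * t = (‖t‖ : 𝕜) := by
  unfold sgn
  split_ifs with h
  · simp [h]
  · rw [div_mul_cancel₀ _ h]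

namespace IsMarkushevichBasis

lemma exists_bound_vectors (hB : IsMarkushevichBasis e f) : ∃ c, 0 < c ∧ ∀ i, ‖e i‖ ≤ c := by
  obtain ⟨c, hc⟩ := hB.bddE
  exact ⟨max c 1, by positivity, fun i => (hc ⟨i, rfl⟩).trans (le_max_left _ _)⟩

lemma exists_bound_functionals (hB : IsMarkushevichBasis e f) :
    ∃ c, 0 < c ∧ ∀ i x, ‖f i x‖ ≤ c * ‖x‖ := by
  obtain ⟨c, hc⟩ := hB.bddF
  exact ⟨max c 1, by positivity, fun i x => ((f i).le_opNorm x).trans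
    (mul_le_mul_of_nonneg_right ((hc ⟨i, rfl⟩).trans (le_max_left _ _)) (norm_nonneg _))⟩

lemma coord_sum (hB : IsMarkushevichBasis e f) (A : Finset ℕ) (a : ℕ → 𝕜) (j : ℕ) :
    f j (∑ i ∈ A, a i • e i) = if j ∈ A then a j else 0 := by
  simp [map_sum, hB.biorth]

lemma coord_proj (hB : IsMarkushevichBasis e f) (A : Finset ℕ) (x : X) (j : ℕ) :
    f j (proj e f A x) = if j ∈ A then f j x else 0 :=
  hB.coord_sum A _ j

lemma ext_coord (hB : IsMarkushevichBasis e f) {x y : X} (h : ∀ i, f i x = f i y) : x = y :=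
  sub_eq_zero.1 (hB.total _ fun i => by rw [map_sub, h, sub_self])

lemma eq_sum_of_coord_eq_zero (hB : IsMarkushevichBasis e f) {Q : Finset ℕ} {v : X}
    (hv : ∀ i ∉ Q, f i v = 0) : v = ∑ i ∈ Q, f i v • e i :=
  hB.ext_coord fun i => by
    rw [hB.coord_sum]
    split_ifs with h
    · rfl
    · exact hv i h

lemma exists_finite_support_near (hB : IsMarkushevichBasis e f) (x : X) {δ : ℝ} (hδ : 0 < δ) :
    ∃ (x' : X) (Q : Finset ℕ), ‖x - x'‖ < δ ∧ ∀ i ∉ Q, f i x' = 0 := by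
  obtain ⟨x', hx', hd⟩ := hB.dense_span.exists_dist_lt x hδ
  obtain ⟨c, rfl⟩ := Finsupp.mem_span_range_iff_exists_finsupp.1 hx'
  refine ⟨_, c.support, by rwa [← dist_eq_norm], fun i hi => ?_⟩
  rw [Finsupp.sum, hB.coord_sum, if_neg hi]

lemma finite_large_coord (hB : IsMarkushevichBasis e f) (x : X) {α : ℝ} (hα : 0 < α) :
    {i | α ≤ ‖f i x‖}.Finite := by
  obtain ⟨c, hc, hf⟩ := hB.exists_bound_functionals
  obtain ⟨x', Q, hx', hQ⟩ := hB.exists_finite_support_near x (div_pos hα hc)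
  refine Q.finite_toSet.subset fun i hi => ?_
  by_contra hiQ
  have h := hf i (x - x')
  rw [map_sub, hQ i hiQ, sub_zero] at h
  have h' : c * ‖x - x'‖ < α := by rwa [lt_div_iff₀' hc] at hx'
  exact absurd (hi.trans h) h'.not_ge

lemma exists_max_coord_not_mem (hB : IsMarkushevichBasis e f) (x : X) (A : Finset ℕ) :
    ∃ j ∉ A, ∀ k ∉ A, ‖f k x‖ ≤ ‖f j x‖ := by
  by_cases h : ∃ k ∉ A, 0 < ‖f k x‖
  · obtain ⟨k, hkA, hk⟩ := h
    have hfin : {i | i ∉ A ∧ ‖f k x‖ ≤ ‖f i x‖}.Finite :=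
      (hB.finite_large_coord x hk).subset fun i hi => hi.2
    obtain ⟨j, hj, hmax⟩ := hfin.exists_maximalFor (fun i => ‖f i x‖) _ ⟨k, hkA, le_rfl⟩
    refine ⟨j, hj.1, fun l hl => ?_⟩
    by_contra hlt
    rw [not_le] at hlt
    exact absurd (hmax ⟨hl, hj.2.trans hlt.le⟩ hlt.le) hlt.not_ge
  · push Not at h
    obtain ⟨j, hj⟩ := A.exists_notMem
    exact ⟨j, hj, fun k hk => (h k hk).trans (norm_nonneg _)⟩

lemma exists_greedySet (hB : IsMarkushevichBasis e f) (x : X) (m : ℕ) :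
    ∃ A, GreedySet f x m 1 A := by
  induction m with
  | zero => exact ⟨∅, by simp [GreedySet]⟩
  | succ m ih =>
    obtain ⟨A, hcard, hA⟩ := ih
    obtain ⟨j, hj, hmax⟩ := hB.exists_max_coord_not_mem x A
    refine ⟨insert j A, by rw [Finset.card_insert_of_notMem hj, hcard], fun i hi k hk => ?_⟩
    have hkA : k ∉ A := fun h => hk (Finset.mem_insert_of_mem h)
    rcases Finset.mem_insert.1 hi with rfl | hi
    · simpa using hmax k hkA
    · exact hA i hi k hkA

end IsMarkushevichBasis

lemma GreedySet.mono {x : X} {m : ℕ} {s t : ℝ} {A : Finset ℕ} (hst : s ≤ t)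
    (h : GreedySet f x m t A) : GreedySet f x m s A :=
  ⟨h.1, fun j hj k hk =>
    (mul_le_mul_of_nonneg_right hst (norm_nonneg _)).trans (h.2 j hj k hk)⟩

end Coordinates

section ConstantCoefficients

variable {e : ℕ → X} {f : ℕ → X →L[𝕜] 𝕜} {w : ℕ → ℝ}

lemma norm_add_sum_smul_le_of_subsets {v : ℕ → X} {M : ℝ} (B : Finset ℕ) {a : ℕ → ℝ}
    (h0 : ∀ i ∈ B, 0 ≤ a i) (h1 : ∀ i ∈ B, a i ≤ 1) (u : X)
    (hM : ∀ D ⊆ B, ‖u + ∑ i ∈ D, v i‖ ≤ M) :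
    ‖u + ∑ i ∈ B, (a i : 𝕜) • v i‖ ≤ M := by
  induction B using Finset.induction_on generalizing u with
  | empty => simpa using hM ∅ subset_rfl
  | insert j B hj ih =>
    have h0' : ∀ i ∈ B, 0 ≤ a i := fun i hi => h0 i (Finset.mem_insert_of_mem hi)
    have h1' : ∀ i ∈ B, a i ≤ 1 := fun i hi => h1 i (Finset.mem_insert_of_mem hi)
    have hout := ih h0' h1' u fun D hD => hM D (hD.trans (Finset.subset_insert _ _))
    have hin := ih h0' h1' (u + v j) fun D hD => by
      have := hM (insert j D) (Finset.insert_subset_insert _ hD)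
      rwa [Finset.sum_insert fun h => hj (hD h), ← add_assoc] at this
    have hj0 := h0 j (Finset.mem_insert_self _ _)
    have hj1 := h1 j (Finset.mem_insert_self _ _)
    have key : u + ∑ i ∈ insert j B, (a i : 𝕜) • v i =
        ((1 - a j : ℝ) : 𝕜) • (u + ∑ i ∈ B, (a i : 𝕜) • v i) +
          (a j : 𝕜) • (u + v j + ∑ i ∈ B, (a i : 𝕜) • v i) := by
      rw [Finset.sum_insert hj]
      push_cast
      module
    rw [key]
    refine (norm_add_le _ _).trans ?_
    rw [norm_smul, norm_smul, RCLike.norm_ofReal, RCLike.norm_ofReal, abs_of_nonneg hj0,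
      abs_of_nonneg (sub_nonneg.2 hj1)]
    nlinarith

lemma norm_sum_smul_le_of_subsets {v : ℕ → X} {M : ℝ} {B : Finset ℕ} {a : ℕ → 𝕜}
    (ha : ∀ i ∈ B, ‖a i‖ ≤ 1) (hM : ∀ D ⊆ B, ‖∑ i ∈ D, v i‖ ≤ M) :
    ‖∑ i ∈ B, a i • v i‖ ≤ 4 * M := by
  have hpos : ∀ b : ℕ → ℝ, (∀ i ∈ B, 0 ≤ b i) → (∀ i ∈ B, b i ≤ 1) →
      ‖∑ i ∈ B, (b i : 𝕜) • v i‖ ≤ M := fun b h0 h1 => by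
    simpa using norm_add_sum_smul_le_of_subsets (𝕜 := 𝕜) B h0 h1 (0 : X) (by simpa using hM)
  have hreal : ∀ b : ℕ → ℝ, (∀ i ∈ B, |b i| ≤ 1) →
      ‖∑ i ∈ B, (b i : 𝕜) • v i‖ ≤ 2 * M := fun b hb => by
    have h1 := hpos (fun i => max (b i) 0) (fun i _ => le_max_right _ _)
      (fun i hi => max_le (abs_le.1 (hb i hi)).2 zero_le_one)
    have h2 := hpos (fun i => max (-b i) 0) (fun i _ => le_max_right _ _)
      (fun i hi => max_le (by linarith [(abs_le.1 (hb i hi)).1]) zero_le_one)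
    have heq : ∑ i ∈ B, (b i : 𝕜) • v i = ∑ i ∈ B, ((max (b i) 0 : ℝ) : 𝕜) • v i -
        ∑ i ∈ B, ((max (-b i) 0 : ℝ) : 𝕜) • v i := by
      rw [← Finset.sum_sub_distrib]
      refine Finset.sum_congr rfl fun i _ => ?_
      rw [← sub_smul, ← RCLike.ofReal_sub, max_zero_sub_max_neg_zero_eq_self]
    rw [heq]
    linarith [norm_sub_le (∑ i ∈ B, ((max (b i) 0 : ℝ) : 𝕜) • v i)
      (∑ i ∈ B, ((max (-b i) 0 : ℝ) : 𝕜) • v i)]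
  have hre := hreal (fun i => RCLike.re (a i)) fun i hi => (RCLike.abs_re_le_norm _).trans (ha i hi)
  have him := hreal (fun i => RCLike.im (a i)) fun i hi => (RCLike.abs_im_le_norm _).trans (ha i hi)
  have heq : ∑ i ∈ B, a i • v i = ∑ i ∈ B, (RCLike.re (a i) : 𝕜) • v i +
      (RCLike.I : 𝕜) • ∑ i ∈ B, (RCLike.im (a i) : 𝕜) • v i := by
    rw [Finset.smul_sum, ← Finset.sum_add_distrib]
    refine Finset.sum_congr rfl fun i _ => ?_
    rw [smul_smul, ← add_smul, mul_comm, RCLike.re_add_im]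
  have hI : ‖(RCLike.I : 𝕜)‖ ≤ 1 := by
    by_cases h : (RCLike.I : 𝕜) = 0
    · simp [h]
    · exact (RCLike.norm_I_of_ne_zero h).le
  rw [heq]
  refine (norm_add_le _ _).trans ?_
  rw [norm_smul]
  nlinarith [mul_le_mul_of_nonneg_right hI
    (norm_nonneg (∑ i ∈ B, (RCLike.im (a i) : 𝕜) • v i))]

lemma norm_sum_smul_le_of_truncation {K : ℝ} (hB : IsMarkushevichBasis e f)
    (hT : TruncationQuasiGreedy e f K) {B : Finset ℕ} {ε a : ℕ → 𝕜}
    (hε : ∀ i ∈ B, ‖ε i‖ = 1) (ha : ∀ i ∈ B, ‖a i‖ ≤ 1) :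
    ‖∑ i ∈ B, a i • e i‖ ≤ 4 * (K * ‖∑ i ∈ B, ε i • e i‖) := by
  set x := ∑ i ∈ B, ε i • e i with hx
  have hsub : ∀ D ⊆ B, ‖∑ i ∈ D, sgn (ε i) • e i‖ ≤ K * ‖x‖ := by
    have hne : ∀ D ⊆ B, D.Nonempty → ‖∑ i ∈ D, sgn (ε i) • e i‖ ≤ K * ‖x‖ := by
      intro D hD hne
      have hcoord : ∀ i ∈ D, f i x = ε i := fun i hi => by
        rw [hx, hB.coord_sum, if_pos (hD hi)]
      have hg : GreedySet f x D.card 1 D := by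
        refine ⟨rfl, fun j hj k _ => ?_⟩
        rw [hcoord j hj, hε j (hD hj), one_mul, hx, hB.coord_sum]
        split_ifs with h
        · exact (hε k h).le
        · simp
      have h := hT x _ D hne hg
      have hinf : (D.inf' hne fun i => ‖f i x‖) = 1 := by
        rw [Finset.inf'_congr hne rfl (g := fun _ => (1 : ℝ)) fun i hi => by
          rw [hcoord i hi, hε i (hD hi)]]
        simp
      rw [hinf, one_mul] at h
      rwa [Finset.sum_congr rfl fun i hi => by rw [hcoord i hi]] at h
    intro D hD
    rcases D.eq_empty_or_nonempty with rfl | h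
    · rcases B.eq_empty_or_nonempty with rfl | h'
      · simp [hx]
      · simpa using (norm_nonneg _).trans (hne B subset_rfl h')
    · exact hne D hD h
  have h := norm_sum_smul_le_of_subsets (a := fun i => a i * (sgn (ε i))⁻¹) (B := B)
    (fun i hi => by rw [norm_mul, norm_inv, norm_sgn, inv_one, mul_one]; exact ha i hi) hsub
  refine le_of_eq_of_le (congrArg _ (Finset.sum_congr rfl fun i _ => ?_)) h
  have : sgn (ε i) ≠ 0 := norm_ne_zero_iff.1 (by rw [norm_sgn]; norm_num)
  rw [smul_smul, inv_mul_cancel_right₀ this]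

/-- For any finite nonempty set `A` of coordinates of modulus at least `α`, the norm of
`α` times the indicator of `A` is controlled by the norm of the vector. -/
lemma mul_norm_sum_le_of_truncation {K α : ℝ} (hB : IsMarkushevichBasis e f) (hK : 0 < K)
    (hT : TruncationQuasiGreedy e f K) (hα : 0 < α) {z : X} {A : Finset ℕ} (hA : A.Nonempty)
    (hz : ∀ i ∈ A, α ≤ ‖f i z‖) :
    α * ‖∑ i ∈ A, e i‖ ≤ 4 * K ^ 2 * ‖z‖ := by
  classical
  set G := (hB.finite_large_coord z hα).toFinset with hG
  have hmem : ∀ i, i ∈ G ↔ α ≤ ‖f i z‖ := fun i => by simp [hG]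
  have hAG : A ⊆ G := fun i hi => (hmem i).2 (hz i hi)
  have hGne : G.Nonempty := hA.mono hAG
  have hgreedy : GreedySet f z G.card 1 G := by
    refine ⟨rfl, fun j hj k hk => ?_⟩
    rw [hmem] at hj hk
    rw [one_mul]
    exact (not_le.1 hk).le.trans hj
  have h1 := hT z _ G hGne hgreedy
  have hinf : α ≤ G.inf' hGne fun i => ‖f i z‖ :=
    Finset.le_inf' _ _ fun i hi => (hmem i).1 hi
  have h2 := norm_sum_smul_le_of_truncation hB hT (B := G) (ε := fun i => sgn (f i z))
    (a := fun i => if i ∈ A then 1 else 0) (fun i _ => norm_sgn _)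
    (fun i _ => by split_ifs <;> simp)
  have h3 : ∑ i ∈ G, (if i ∈ A then (1 : 𝕜) else 0) • e i = ∑ i ∈ A, e i := by
    simp only [ite_smul, one_smul, zero_smul]
    rw [← Finset.sum_filter, Finset.filter_mem_eq_inter, Finset.inter_eq_right.2 hAG]
  rw [h3] at h2
  calc α * ‖∑ i ∈ A, e i‖ ≤ α * (4 * (K * ‖∑ i ∈ G, sgn (f i z) • e i‖)) := by gcongr
    _ = 4 * K * (α * ‖∑ i ∈ G, sgn (f i z) • e i‖) := by ring
    _ ≤ 4 * K * (K * ‖z‖) :=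
      mul_le_mul_of_nonneg_left
        ((mul_le_mul_of_nonneg_right hinf (norm_nonneg _)).trans h1) (by positivity)
    _ = _ := by ring

lemma norm_le_of_disjoint_weakGreedySet {K L s : ℝ} (hB : IsMarkushevichBasis e f)
    (hw : ∀ i, 0 < w i) (hK : 0 < K) (hL : 0 < L) (hs : 0 < s)
    (hT : TruncationQuasiGreedy e f K) (hD : Democratic e f w L) {x : X} {m : ℕ}
    {A B : Finset ℕ} (hA : GreedySet f x m s A) (hdisj : Disjoint A B)
    (hBA : wsum w (B : Set ℕ) ≤ wsum w (A : Set ℕ)) :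
    ‖x‖ ≤ (1 + 16 * K ^ 3 * L / s) * ‖x - proj e f B x‖ := by
  suffices h : ‖proj e f B x‖ ≤ 16 * K ^ 3 * L / s * ‖x - proj e f B x‖ by
    have := norm_add_le (x - proj e f B x) (proj e f B x)
    rw [sub_add_cancel] at this
    linarith
  have htriv : (∀ i ∈ B, f i x = 0) →
      ‖proj e f B x‖ ≤ 16 * K ^ 3 * L / s * ‖x - proj e f B x‖ := by
    intro h
    have : proj e f B x = 0 := Finset.sum_eq_zero fun i hi => by rw [h i hi, zero_smul]
    rw [this, norm_zero]
    positivity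
  rcases A.eq_empty_or_nonempty with rfl | hne
  · rw [wsum_le_wsum_iff hw, Finset.sum_empty] at hBA
    rw [eq_empty_of_sum_weight_nonpos hw hBA] at htriv ⊢
    exact htriv (by simp)
  obtain ⟨j, hj, hmin⟩ := A.exists_min_image (fun i => ‖f i x‖) hne
  have hBbound : ∀ k ∈ B, ‖f k x‖ ≤ ‖f j x‖ / s := fun k hk => by
    rw [le_div_iff₀' hs]
    exact hA.2 j hj k (Finset.disjoint_right.1 hdisj hk)
  rcases (norm_nonneg (f j x)).eq_or_lt with h0 | hα
  · exact htriv fun i hi => norm_le_zero_iff.1 (by simpa [← h0] using hBbound i hi)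
  set α := ‖f j x‖ with hαdef
  have h1 := norm_sum_smul_le_of_truncation hB hT (B := B) (ε := fun _ => 1)
    (a := fun i => ((s / α : ℝ) : 𝕜) * f i x) (by simp) (fun i hi => by
      rw [norm_mul, RCLike.norm_ofReal, abs_of_pos (div_pos hs hα)]
      calc s / α * ‖f i x‖ ≤ s / α * (α / s) := by gcongr; exact hBbound i hi
        _ = 1 := by field_simp)
  simp only [one_smul, mul_smul] at h1
  rw [← Finset.smul_sum, norm_smul, RCLike.norm_ofReal, abs_of_pos (div_pos hs hα)] at h1
  have h2 := hD B A hBA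
  have h3 := mul_norm_sum_le_of_truncation hB hK hT hα (z := x - proj e f B x) hne
    (fun i hi => by
      rw [map_sub, hB.coord_proj, if_neg (Finset.disjoint_left.1 hdisj hi), sub_zero]
      exact hmin i hi)
  change s / α * ‖proj e f B x‖ ≤ _ at h1
  calc ‖proj e f B x‖ = α / s * (s / α * ‖proj e f B x‖) := by field_simp
    _ ≤ α / s * (4 * (K * (L * ‖∑ i ∈ A, e i‖))) :=
      mul_le_mul_of_nonneg_left (h1.trans (by gcongr)) (by positivity)
    _ = 4 * K * L / s * (α * ‖∑ i ∈ A, e i‖) := by ring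
    _ ≤ 4 * K * L / s * (4 * K ^ 2 * ‖x - proj e f B x‖) := by gcongr
    _ = _ := by ring

lemma almostSemiGreedy_of_disjoint_bound {K s : ℝ} (hB : IsMarkushevichBasis e f)
    (hw : ∀ i, 0 < w i) (hs1 : s ≤ 1)
    (h : ∀ (x : X) (B : Finset ℕ), (∃ (m : ℕ) (A : Finset ℕ), GreedySet f x m s A ∧
      Disjoint A B ∧ wsum w (B : Set ℕ) ≤ wsum w (A : Set ℕ)) →
        ‖x‖ ≤ K * ‖x - proj e f B x‖) :
    AlmostSemiGreedy e f w K s := by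
  intro x m
  obtain ⟨A, hA⟩ := hB.exists_greedySet x m
  replace hA := hA.mono hs1
  obtain ⟨D, hD, hmin⟩ := A.powerset.exists_min_image (fun D => ‖x - proj e f D x‖)
    ⟨∅, Finset.empty_mem_powerset _⟩
  refine ⟨A, hA, proj e f D x, fun i hi => ?_, fun B hBA => ?_⟩
  · by_contra hiA
    exact hi (by rw [hB.coord_proj, if_neg fun h => hiA (Finset.mem_powerset.1 hD h)])
  refine (hmin (A ∩ B) (Finset.mem_powerset.2 Finset.inter_subset_left)).trans ?_
  have hcoord : ∀ i, f i (x - proj e f (A ∩ B) x) = if i ∈ A ∩ B then 0 else f i x := by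
    intro i
    rw [map_sub, hB.coord_proj]
    split_ifs <;> simp
  have heq : x - proj e f (A ∩ B) x - proj e f (B \ A) (x - proj e f (A ∩ B) x) =
      x - proj e f B x := by
    refine hB.ext_coord fun i => ?_
    rw [map_sub, hB.coord_proj, hcoord, map_sub, hB.coord_proj]
    by_cases hiA : i ∈ A <;> by_cases hiB : i ∈ B <;> simp [hiA, hiB]
  rw [← heq]
  refine h _ _ ⟨_, A \ B, ⟨rfl, fun j hj k hk => ?_⟩, ?_, ?_⟩
  · rw [Finset.mem_sdiff] at hj hk
    rw [hcoord, hcoord, if_neg (fun h => hj.2 (Finset.mem_inter.1 h).2)]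
    split_ifs with hkAB
    · simp
    · exact hA.2 j hj.1 k fun hkA => hkAB (Finset.mem_inter.2
        ⟨hkA, by_contra fun hkB => hk ⟨hkA, hkB⟩⟩)
  · exact Finset.disjoint_left.2 fun i hi hi' =>
      (Finset.mem_sdiff.1 hi').2 (Finset.mem_sdiff.1 hi).1
  · rw [wsum_le_wsum_iff hw] at hBA ⊢
    have h1 := Finset.sum_inter_add_sum_sdiff A B w
    have h2 := Finset.sum_inter_add_sum_sdiff B A w
    rw [Finset.inter_comm] at h2
    linarith

end ConstantCoefficients

section Absorption

variable {e : ℕ → X} {f : ℕ → X →L[𝕜] 𝕜} {w : ℕ → ℝ}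

/-- Every sum with coefficients bounded by one over a finite set disjoint from `Q` of weight at
most `b` lies within distance `D` of the span of the basis vectors indexed by `Q`. -/
def Absorbs (e : ℕ → X) (f : ℕ → X →L[𝕜] 𝕜) (w : ℕ → ℝ) (Q : Finset ℕ) (b D : ℝ) : Prop :=
  ∀ (E : Finset ℕ) (a : ℕ → 𝕜), Disjoint E Q → (∀ i ∈ E, ‖a i‖ ≤ 1) → ∑ i ∈ E, w i ≤ b →
    ∃ v : X, (∀ i ∉ Q, f i v = 0) ∧ ‖∑ i ∈ E, a i • e i + v‖ ≤ D

lemma absorbs_of_unimodular {K s : ℝ} (hB : IsMarkushevichBasis e f) (hw : ∀ i, 0 < w i)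
    (hs : 0 < s) (hASG : AlmostSemiGreedy e f w K s) (B : Finset ℕ) {ε : ℕ → 𝕜}
    (hε : ∀ i ∈ B, ‖ε i‖ = 1) :
    Absorbs e f w B (∑ i ∈ B, w i) (2 * K / s * ‖∑ i ∈ B, ε i • e i‖) := by
  intro E a hEB ha hwE
  set u := ∑ i ∈ E, a i • e i with hu
  set v := ((2 / s : ℝ) : 𝕜) • ∑ i ∈ B, ε i • e i with hv
  have hcoord : ∀ i, f i (u + v) =
      (if i ∈ E then a i else 0) + if i ∈ B then ((2 / s : ℝ) : 𝕜) * ε i else 0 := by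
    intro i
    rw [map_add, hu, hB.coord_sum, hv, map_smul, hB.coord_sum]
    split_ifs <;> simp
  obtain ⟨A, ⟨hcard, hA⟩, y, hy, hmin⟩ := hASG (u + v) B.card
  have hAB : A = B := by
    refine Finset.eq_of_subset_of_card_le (fun k hk => ?_) hcard.ge
    by_contra hkB
    obtain ⟨j, hjB, hjA⟩ : ∃ j ∈ B, j ∉ A := by
      by_contra! h
      exact hkB ((Finset.eq_of_subset_of_card_le h hcard.le).symm ▸ hk)
    have h := hA k hk j hjA
    rw [hcoord, hcoord, if_neg (Finset.disjoint_right.1 hEB hjB), if_pos hjB, if_neg hkB, zero_add,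
      add_zero, norm_mul, RCLike.norm_ofReal, hε j hjB, abs_of_pos (by positivity), mul_one,
      mul_div_cancel₀ _ hs.ne'] at h
    split_ifs at h with hkE
    · linarith [ha k hkE]
    · simp at h; linarith
  subst hAB
  have h := hmin E ((wsum_le_wsum_iff hw _ _).2 hwE)
  have hproj : u + v - proj e f E (u + v) = v := by
    refine hB.ext_coord fun i => ?_
    rw [map_sub, hB.coord_proj, hcoord, hv, map_smul, hB.coord_sum]
    by_cases hiE : i ∈ E
    · simp [hiE, Finset.disjoint_left.1 hEB hiE]
    · simp [hiE]
  rw [hproj] at h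
  refine ⟨v - y, fun i hi => ?_, ?_⟩
  · have hyi : f i y = 0 := by
      by_contra hne
      exact hi (hy hne)
    rw [map_sub, hyi, hv, map_smul, hB.coord_sum, if_neg hi]
    simp
  · rw [← add_sub_assoc]
    refine h.trans_eq ?_
    rw [hv, norm_smul, RCLike.norm_ofReal, abs_of_pos (by positivity)]
    ring

lemma absorbs_of_large_coord {K s α : ℝ} (hB : IsMarkushevichBasis e f) (hw : ∀ i, 0 < w i)
    (hs : 0 < s) (hs1 : s ≤ 1) (hASG : AlmostSemiGreedy e f w K s) (hα : 0 < α) {x : X}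
    {A Q : Finset ℕ} (hQ : ∀ i ∉ Q, f i x = 0) (hA : ∀ i ∈ A, α ≤ ‖f i x‖) :
    Absorbs e f w Q (∑ i ∈ A, w i) (2 * K / (s ^ 2 * α) * ‖x‖) := by
  intro E a hEQ ha hwE
  set κ : ℝ := s ^ 2 * α / 2 with hκ
  have hκ0 : 0 < κ := by positivity
  set u := ∑ i ∈ E, a i • e i with hu
  set z := x + (κ : 𝕜) • u with hz
  have hzE : ∀ i ∈ E, ‖f i z‖ ≤ κ := fun i hi => by
    rw [hz, map_add, hQ i (Finset.disjoint_left.1 hEQ hi), map_smul, hu, hB.coord_sum, if_pos hi,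
      zero_add, smul_eq_mul, norm_mul, RCLike.norm_ofReal, abs_of_pos hκ0]
    exact mul_le_of_le_one_right hκ0.le (ha i hi)
  have hzE' : ∀ i ∉ E, f i z = f i x := fun i hi => by
    rw [hz, map_add, map_smul, hu, hB.coord_sum, if_neg hi, smul_zero, add_zero]
  have hzQ : ∀ i ∈ Q, f i z = f i x := fun i hi => hzE' i (Finset.disjoint_right.1 hEQ hi)
  have hAQ : A ⊆ Q := fun i hi => by
    by_contra h
    have := hA i hi
    rw [hQ i h, norm_zero] at this
    linarith
  set G := Q.filter fun i => s * α ≤ ‖f i x‖ with hG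
  have hsα : s * α ≤ α := mul_le_of_le_one_left hα.le hs1
  have hAG : A ⊆ G := fun i hi => Finset.mem_filter.2 ⟨hAQ hi, hsα.trans (hA i hi)⟩
  obtain ⟨A', ⟨hcard, hA'⟩, y, hy, hmin⟩ := hASG z G.card
  have hA'Q : A' ⊆ Q := by
    by_cases hGA : G ⊆ A'
    · rw [← Finset.eq_of_subset_of_card_le hGA hcard.le]
      exact Finset.filter_subset _ _
    obtain ⟨j, hjG, hjA⟩ := Finset.not_subset.1 hGA
    rw [Finset.mem_filter] at hjG
    intro k hk
    by_contra hkQ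
    have h := hA' k hk j hjA
    rw [hzQ j hjG.1] at h
    have h1 : 2 * κ ≤ ‖f k z‖ := by
      refine le_trans ?_ h
      rw [hκ]
      nlinarith [hjG.2]
    by_cases hkE : k ∈ E
    · linarith [hzE k hkE]
    · rw [hzE' k hkE, hQ k hkQ, norm_zero] at h1
      linarith
  have hAA' : A ⊆ A' := by
    intro j hj
    by_contra hjA
    have hsub : A' ⊆ G := fun k hk => by
      have h := hA' k hk j hjA
      rw [hzQ k (hA'Q hk), hzQ j (hAQ hj)] at h
      exact Finset.mem_filter.2 ⟨hA'Q hk, (mul_le_mul_of_nonneg_left (hA j hj) hs.le).trans h⟩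
    rw [Finset.eq_of_subset_of_card_le hsub hcard.ge] at hjA
    exact hjA (hAG hj)
  have h := hmin E ((wsum_le_wsum_iff hw _ _).2 (hwE.trans
    (Finset.sum_le_sum_of_subset_of_nonneg hAA' fun i _ _ => (hw i).le)))
  have hproj : z - proj e f E z = x := by
    refine hB.ext_coord fun i => ?_
    rw [map_sub, hB.coord_proj]
    split_ifs with hi
    · rw [sub_self, hQ i (Finset.disjoint_left.1 hEQ hi)]
    · rw [sub_zero, hzE' i hi]
  rw [hproj] at h
  have hκ' : (κ : 𝕜) ≠ 0 := by exact_mod_cast hκ0.ne'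
  refine ⟨(κ : 𝕜)⁻¹ • (x - y), fun i hi => ?_, ?_⟩
  · have hyi : f i y = 0 := by
      by_contra hne
      exact hi (hA'Q (hy hne))
    rw [map_smul, map_sub, hyi, hQ i hi, sub_zero, smul_zero]
  · have heq : u + (κ : 𝕜)⁻¹ • (x - y) = (κ : 𝕜)⁻¹ • (z - y) := by
      rw [hz, smul_sub, smul_sub, smul_add, smul_smul, inv_mul_cancel₀ hκ', one_smul]
      abel
    rw [heq, norm_smul, norm_inv, RCLike.norm_ofReal, abs_of_pos hκ0]
    calc κ⁻¹ * ‖z - y‖ ≤ κ⁻¹ * (K * ‖x‖) := by gcongr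
      _ = _ := by rw [hκ]; field_simp

lemma exists_linear_bound {K s : ℝ} (hB : IsMarkushevichBasis e f) (hw : ∀ i, 0 < w i)
    (hs : 0 < s) (hASG : AlmostSemiGreedy e f w K s) :
    ∃ M, 0 < M ∧ ∀ (A : Finset ℕ) (a : ℕ → 𝕜), (∀ i ∈ A, ‖a i‖ ≤ 1) →
      ‖∑ i ∈ A, a i • e i‖ ≤ M * (1 + ∑ i ∈ A, w i) := by
  obtain ⟨cE, hcE, hE⟩ := hB.exists_bound_vectors
  obtain ⟨cF, hcF, hF⟩ := hB.exists_bound_functionals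
  have habs := absorbs_of_unimodular hB hw hs hASG {0} (ε := fun _ => 1) (by simp)
  set D := 2 * K / s * ‖∑ i ∈ ({0} : Finset ℕ), (1 : 𝕜) • e i‖ with hD
  rw [Finset.sum_singleton] at habs
  have hD0 : 0 ≤ D := by
    obtain ⟨v, -, hv⟩ := habs ∅ 0 (by simp) (by simp) (by simpa using (hw 0).le)
    exact (norm_nonneg _).trans hv
  have hterm : ∀ (a : ℕ → 𝕜) (i : ℕ), ‖a i‖ ≤ 1 → ‖a i • e i‖ ≤ cE := fun a i ha => by
    rw [norm_smul]
    exact (mul_le_of_le_one_left (norm_nonneg _) ha).trans (hE i)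
  have hsmall0 : ∀ (A : Finset ℕ) (a : ℕ → 𝕜), (∀ i ∈ A, ‖a i‖ ≤ 1) → 0 ∉ A →
      ∑ i ∈ A, w i ≤ w 0 → ‖∑ i ∈ A, a i • e i‖ ≤ D + cF * D * cE := by
    intro A a ha h0 hwA
    obtain ⟨v, hv0, hv⟩ := habs A a (by simpa using h0) ha hwA
    have hveq := hB.eq_sum_of_coord_eq_zero hv0
    rw [Finset.sum_singleton] at hveq
    have hc : ‖f 0 v‖ ≤ cF * D := by
      have := (hF 0 (∑ i ∈ A, a i • e i + v)).trans (mul_le_mul_of_nonneg_left hv hcF.le)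
      rwa [map_add, hB.coord_sum, if_neg h0, zero_add] at this
    have hvn : ‖v‖ ≤ cF * D * cE := by
      rw [hveq, norm_smul]
      exact mul_le_mul hc (hE 0) (norm_nonneg _) (by positivity)
    calc _ = ‖(∑ i ∈ A, a i • e i + v) - v‖ := by rw [add_sub_cancel_right]
      _ ≤ _ := (norm_sub_le _ _).trans (add_le_add hv hvn)
  set M := D + cF * D * cE + cE with hM
  have hM0 : 0 < M := by positivity
  have hsmall : ∀ (A : Finset ℕ) (a : ℕ → 𝕜), (∀ i ∈ A, ‖a i‖ ≤ 1) →
      ∑ i ∈ A, w i ≤ w 0 → ‖∑ i ∈ A, a i • e i‖ ≤ M := by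
    intro A a ha hwA
    by_cases h0 : 0 ∈ A
    · have h1 := hsmall0 (A.erase 0) a (fun i hi => ha i (Finset.mem_of_mem_erase hi))
        (Finset.notMem_erase _ _) ((Finset.sum_le_sum_of_subset_of_nonneg
          (Finset.erase_subset _ _) fun i _ _ => (hw i).le).trans hwA)
      rw [← Finset.add_sum_erase A _ h0]
      refine (norm_add_le _ _).trans ?_
      linarith [hterm a 0 (ha 0 h0)]
    · linarith [hsmall0 A a ha h0 hwA]
  refine ⟨M * (1 + 2 / w 0), mul_pos hM0 (by have := hw 0; positivity), fun A a ha => ?_⟩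
  have h := linear_bound_of_subadditive hw (hw 0) hM0.le (S := (A : Set ℕ))
    (R := fun A r => ‖∑ i ∈ A, a i • e i‖ ≤ r)
    (fun A A' r r' hd h h' => by
      rw [Finset.sum_union hd]; exact (norm_add_le _ _).trans (add_le_add h h'))
    (fun _ _ _ hr h => h.trans hr)
    (fun A' hA' hwA' => hsmall A' a (fun i hi => ha i (hA' hi)) hwA')
    (fun i hi => by
      rw [Finset.sum_singleton]
      refine (hterm a i (ha i hi)).trans ?_
      rw [hM]
      linarith [show 0 ≤ D + cF * D * cE by positivity])
    A subset_rfl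
  refine h.trans ?_
  rw [mul_assoc]
  refine mul_le_mul_of_nonneg_left ?_ hM0.le
  have hw0 := hw 0
  have hsum : 0 ≤ ∑ i ∈ A, w i := Finset.sum_nonneg fun i _ => (hw i).le
  have h2 : 0 ≤ 2 / w 0 := by positivity
  rw [mul_div_right_comm]
  nlinarith

end Absorption

section Compactness

variable {e : ℕ → X} {f : ℕ → X →L[𝕜] 𝕜} {w : ℕ → ℝ}

lemma not_totallyBounded_range_of_escaping [CompleteSpace X] (hB : IsMarkushevichBasis e f)
    {u : ℕ → X} (hu : ∀ n k, n < k → f n (u k) = 0) (g : X →L[𝕜] 𝕜) {η : ℝ} (hη : 0 < η)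
    (hg : ∀ k, η ≤ ‖g (u k)‖) : ¬ TotallyBounded (Set.range u) := by
  intro htb
  have hc : IsCompact (closure (Set.range u)) :=
    htb.closure.isCompact_of_isClosed isClosed_closure
  obtain ⟨z, -, φ, hφ, hlim⟩ := hc.tendsto_subseq fun n => subset_closure ⟨n, rfl⟩
  have hz : z = 0 := hB.total z fun n => by
    refine tendsto_nhds_unique (((f n).continuous.tendsto z).comp hlim)
      (tendsto_const_nhds.congr' ?_)
    filter_upwards [eventually_gt_atTop n] with k hk
    exact (hu n (φ k) (hk.trans_le (hφ.id_le k))).symm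
  have h := ge_of_tendsto ((g.continuous.norm.tendsto z).comp hlim)
    (Eventually.of_forall fun k => hg (φ k))
  rw [hz, map_zero, norm_zero] at h
  exact absurd hη h.not_gt

lemma totallyBounded_bounded_coord (hB : IsMarkushevichBasis e f) (Q : Finset ℕ) {R : ℝ}
    (hR : 0 ≤ R) : TotallyBounded {v : X | (∀ i ∉ Q, f i v = 0) ∧ ∀ i ∈ Q, ‖f i v‖ ≤ R} := by
  have hc : Continuous fun c : Q → 𝕜 => ∑ i : Q, c i • e i := by fun_prop
  refine ((isCompact_closedBall (0 : Q → 𝕜) R).image hc).totallyBounded.subset ?_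
  rintro v ⟨hv, hvR⟩
  refine ⟨fun i => f i v, ?_, ?_⟩
  · rw [mem_closedBall_zero_iff, pi_norm_le_iff_of_nonneg hR]
    exact fun i => hvR i i.2
  · conv_rhs => rw [hB.eq_sum_of_coord_eq_zero hv]
    exact Finset.sum_coe_sort Q fun i => f i v • e i

lemma exists_finite_dual_net (e : ℕ → X) (Q : Finset ℕ) {δ : ℝ} (hδ : 0 < δ) :
    ∃ S : Set (X →L[𝕜] 𝕜), S.Finite ∧ (∀ g ∈ S, ‖g‖ ≤ 1) ∧
      ∀ g : X →L[𝕜] 𝕜, ‖g‖ ≤ 1 → ∃ g' ∈ S, ∀ i ∈ Q, ‖(g - g') (e i)‖ ≤ δ := by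
  set Φ : (X →L[𝕜] 𝕜) → Q → 𝕜 := fun g i => g (e i) with hΦ
  have hb : Bornology.IsBounded (Φ '' Metric.closedBall 0 1) := by
    rw [Metric.isBounded_iff_subset_closedBall (0 : Q → 𝕜)]
    refine ⟨∑ i ∈ Q, ‖e i‖, ?_⟩
    rintro _ ⟨g, hg, rfl⟩
    rw [mem_closedBall_zero_iff] at hg ⊢
    rw [pi_norm_le_iff_of_nonneg (Finset.sum_nonneg fun i _ => norm_nonneg _)]
    intro i
    calc ‖g (e i)‖ ≤ 1 * ‖e i‖ := g.le_of_opNorm_le hg _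
      _ ≤ _ := by
        rw [one_mul]
        exact Finset.single_le_sum (f := fun i => ‖e i‖) (fun i _ => norm_nonneg _) i.2
  have htb : TotallyBounded (Φ '' Metric.closedBall 0 1) :=
    hb.isCompact_closure.totallyBounded.subset subset_closure
  obtain ⟨S, hS, hfin, hcov⟩ := Set.exists_subset_image_finite_and.1
    (Metric.finite_approx_of_totallyBounded htb δ hδ)
  refine ⟨S, hfin, fun g hg => by simpa using hS hg, fun g hg => ?_⟩
  have h := hcov ⟨g, by simpa using hg, rfl⟩
  simp only [Set.mem_iUnion, Set.mem_image, Metric.mem_ball] at h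
  obtain ⟨_, ⟨g', hg', rfl⟩, hd⟩ := h
  refine ⟨g', hg', fun i hi => ?_⟩
  rw [dist_eq_norm] at hd
  exact (norm_le_pi_norm (Φ g - Φ g') ⟨i, hi⟩).trans hd.le

end Compactness

section Recovery

variable {e : ℕ → X} {f : ℕ → X →L[𝕜] 𝕜} {w : ℕ → ℝ}

lemma Absorbs.nonneg {Q : Finset ℕ} {b D : ℝ} (h : Absorbs e f w Q b D) (hb : 0 ≤ b) : 0 ≤ D := by
  obtain ⟨v, -, hv⟩ := h ∅ 0 (by simp) (by simp) (by simpa using hb)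
  exact (norm_nonneg _).trans hv

lemma Absorbs.linear_growth {Q : Finset ℕ} {b D c : ℝ} (hw : ∀ i, 0 < w i) (hb : 0 < b)
    (h : Absorbs e f w Q b D) (hE : ∀ i, ‖e i‖ ≤ c) {A : Finset ℕ} {a : ℕ → 𝕜}
    (hAQ : Disjoint A Q) (ha : ∀ i, ‖a i‖ ≤ 1) :
    ∃ v : X, (∀ i ∉ Q, f i v = 0) ∧
      ‖∑ i ∈ A, a i • e i + v‖ ≤ max D c * (1 + 2 * (∑ i ∈ A, w i) / b) := by
  refine linear_bound_of_subadditive hw hb ((h.nonneg hb.le).trans (le_max_left _ _))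
    (S := {i | i ∉ Q})
    (R := fun A r => ∃ v : X, (∀ i ∉ Q, f i v = 0) ∧ ‖∑ i ∈ A, a i • e i + v‖ ≤ r)
    ?_ ?_ ?_ ?_ A fun i hi => Finset.disjoint_left.1 hAQ hi
  · rintro A A' r r' hd ⟨v, hv, h⟩ ⟨v', hv', h'⟩
    refine ⟨v + v', fun i hi => by rw [map_add, hv i hi, hv' i hi, add_zero], ?_⟩
    rw [Finset.sum_union hd, add_add_add_comm]
    exact (norm_add_le _ _).trans (add_le_add h h')
  · rintro A r r' hr ⟨v, hv, h⟩
    exact ⟨v, hv, h.trans hr⟩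
  · intro A hA hwA
    obtain ⟨v, hv, hD⟩ := h A a (Finset.disjoint_left.2 fun i hi => hA hi) (fun i _ => ha i) hwA
    exact ⟨v, hv, hD.trans (le_max_left _ _)⟩
  · intro i _
    refine ⟨0, by simp, ?_⟩
    rw [Finset.sum_singleton, add_zero, norm_smul]
    exact (mul_le_of_le_one_left (norm_nonneg _) (ha i)).trans ((hE i).trans (le_max_right _ _))

/-- If some functional is not small against the weight, absorption is only possible with a bound
proportional to the absorbed weight. -/
lemma exists_weight_le_of_absorbs [CompleteSpace X] (hB : IsMarkushevichBasis e f)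
    (hw : ∀ i, 0 < w i) (g : X →L[𝕜] 𝕜) {η : ℝ} (hη : 0 < η)
    (hH : ¬ LightSet w {n | η * w n < ‖g (e n)‖}) :
    ∃ C, 0 < C ∧ ∀ Q b D, 0 ≤ b → Absorbs e f w Q b D → b ≤ C * (D + 1) := by
  obtain ⟨cE, hcE, hE⟩ := hB.exists_bound_vectors
  obtain ⟨cF, hcF, hF⟩ := hB.exists_bound_functionals
  choose A hAH hAd hAw using fun k : ℕ =>
    exists_disjoint_heavy_of_not_light hw hH (Finset.range k) (k + 1 : ℝ)
  set W : ℕ → ℝ := fun k => ∑ i ∈ A k, w i with hW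
  have hWk : ∀ k : ℕ, (k + 1 : ℝ) < W k := hAw
  have hW0 : ∀ k, 0 < W k := fun k => lt_trans (by positivity) (hWk k)
  set σ : ℕ → 𝕜 := fun n => sgn (g (e n)) with hσ
  set u : ℕ → X := fun k => ((W k)⁻¹ : 𝕜) • ∑ i ∈ A k, σ i • e i with hu
  have hucoord : ∀ n k, n < k → f n (u k) = 0 := fun n k hnk => by
    rw [hu, map_smul, hB.coord_sum, if_neg (Finset.disjoint_right.1 (hAd k)
      (Finset.mem_range.2 hnk)), smul_zero]
  have hgu : ∀ k, η ≤ ‖g (u k)‖ := fun k => by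
    have h1 : g (u k) = (((W k)⁻¹ * ∑ i ∈ A k, ‖g (e i)‖ : ℝ) : 𝕜) := by
      simp only [hu, hσ, map_smul, map_sum, smul_eq_mul, sgn_mul_self]
      push_cast
      rfl
    rw [h1, RCLike.norm_ofReal, inv_mul_eq_div]
    refine le_trans ?_ (le_abs_self _)
    rw [le_div_iff₀ (hW0 k), hW, Finset.mul_sum]
    exact Finset.sum_le_sum fun i hi => (hAH k hi).le
  have hntb := not_totallyBounded_range_of_escaping hB hucoord g hη hgu
  rw [Metric.totallyBounded_iff] at hntb
  push Not at hntb
  obtain ⟨δ, hδ, hnet⟩ := hntb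
  refine ⟨6 * (1 + cE) / δ, by positivity, fun Q b D hb0 habs => ?_⟩
  have hD := habs.nonneg hb0
  rcases hb0.eq_or_lt with rfl | hb
  · positivity
  set D₁ := max D cE with hD₁
  have hD₁0 : 0 < D₁ := hcE.trans_le (le_max_right _ _)
  have hmain : b ≤ 6 * D₁ / δ := by
    by_contra hlt
    rw [not_le, div_lt_iff₀ hδ] at hlt
    have hsmall : 3 * D₁ / b < δ / 2 := by
      rw [div_lt_iff₀ hb]
      linarith
    obtain ⟨N₁, hN₁⟩ := exists_nat_ge b
    set N := max N₁ (Q.sup id + 1) with hN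
    have hclose : ∀ k, N ≤ k → ∃ v : X, (∀ i ∉ Q, f i v = 0) ∧ ‖u k + v‖ ≤ 3 * D₁ / b := by
      intro k hk
      have hQk : Q ⊆ Finset.range k := fun i hi => by
        have := Finset.le_sup (f := id) hi
        simp only [id] at this
        rw [Finset.mem_range]
        have := le_max_right N₁ (Q.sup id + 1)
        omega
      obtain ⟨v, hv, hle⟩ := habs.linear_growth hw hb hE
        ((hAd k).mono_right hQk) (a := σ) (fun i => (norm_sgn _).le)
      refine ⟨((W k)⁻¹ : 𝕜) • v, fun i hi => by rw [map_smul, hv i hi, smul_zero], ?_⟩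
      rw [hu, ← smul_add, norm_smul, norm_inv, RCLike.norm_ofReal, abs_of_pos (hW0 k),
        inv_mul_eq_div, div_le_iff₀ (hW0 k)]
      refine hle.trans ?_
      have hbW : b ≤ W k := by
        have h1 : (N₁ : ℝ) ≤ k := by exact_mod_cast (le_max_left _ _).trans hk
        linarith [hWk k]
      have : 1 ≤ W k / b := (one_le_div hb).2 hbW
      calc D₁ * (1 + 2 * W k / b) ≤ D₁ * (W k / b + 2 * W k / b) := by gcongr
        _ = _ := by ring
    obtain ⟨t, htfin, ht⟩ := Metric.totallyBounded_iff.1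
      (totallyBounded_bounded_coord hB Q (R := cF * (3 * D₁ / b)) (by positivity)) (δ / 2) (by positivity)
    refine hnet (t ∪ u '' Set.Iio N) (htfin.union ((Set.finite_Iio N).image u)) ?_
    rintro _ ⟨k, rfl⟩
    simp only [Set.mem_iUnion]
    rcases lt_or_ge k N with hk | hk
    · exact ⟨u k, Or.inr ⟨k, hk, rfl⟩, Metric.mem_ball_self hδ⟩
    obtain ⟨v, hv, hle⟩ := hclose k hk
    have hmem := ht (a := -v) ⟨fun i hi => by rw [map_neg, hv i hi, neg_zero], fun i hi => by
      have hik : i < k := by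
        have := Finset.le_sup (f := id) hi
        simp only [id] at this
        have := le_max_right N₁ (Q.sup id + 1)
        omega
      have h1 := hF i (u k + v)
      rw [map_add, hucoord i k hik, zero_add] at h1
      rw [map_neg, norm_neg]
      exact h1.trans (mul_le_mul_of_nonneg_left hle hcF.le)⟩
    simp only [Set.mem_iUnion] at hmem
    obtain ⟨y, hy, hd⟩ := hmem
    refine ⟨y, Or.inl hy, ?_⟩
    have h1 : dist (u k) (-v) < δ / 2 := by
      rw [dist_eq_norm, sub_neg_eq_add]
      exact hle.trans_lt hsmall
    rw [Metric.mem_ball] at hd ⊢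
    linarith [dist_triangle (u k) (-v) y]
  refine hmain.trans ?_
  rw [div_mul_eq_mul_div, div_le_div_iff_of_pos_right hδ, mul_assoc]
  have : D₁ ≤ (1 + cE) * (D + 1) := max_le (by nlinarith) (by nlinarith)
  linarith

/-- If every functional is small against the weight outside a light set, a far away set of
comparable weight transfers absorption to a norm bound. -/
lemma exists_norm_le_of_absorbs_of_small {K s : ℝ} (hB : IsMarkushevichBasis e f)
    (hw : ∀ i, 0 < w i) (hs : 0 < s) (hK : 0 < K) (hASG : AlmostSemiGreedy e f w K s)
    (hheavy : ¬ LightSet w Set.univ)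
    (hsmall : ∀ (g : X →L[𝕜] 𝕜) (η : ℝ), 0 < η → LightSet w {n | η * w n < ‖g (e n)‖}) :
    ∃ C, 0 < C ∧ ∀ Q b D, Absorbs e f w Q b D → ∀ (A : Finset ℕ) (a : ℕ → 𝕜),
      (∀ i ∈ A, ‖a i‖ ≤ 1) → ∑ i ∈ A, w i ≤ b → ‖∑ i ∈ A, a i • e i‖ ≤ C * (D + 1) := by
  obtain ⟨cE, hcE, hE⟩ := hB.exists_bound_vectors
  obtain ⟨cF, hcF, hF⟩ := hB.exists_bound_functionals
  refine ⟨(1 + cF * (1 + cE)) * (2 * K / s) * (3 + cE), by positivity,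
    fun Q b D habs A a ha hwA => ?_⟩
  set t := ∑ i ∈ A, w i with ht
  have ht0 : 0 ≤ t := Finset.sum_nonneg fun i _ => (hw i).le
  have hD0 := habs.nonneg (ht0.trans hwA)
  set u := ∑ i ∈ A, a i • e i with hu
  obtain ⟨g₀, hg₀, hg₀u⟩ := exists_dual_vector'' 𝕜 u
  set δ := 1 / ((Q.card + 1) * cF) with hδ
  have hδ0 : 0 < δ := by positivity
  obtain ⟨S, hSfin, hS1, hSnet⟩ := exists_finite_dual_net (𝕜 := 𝕜) e Q hδ0
  set η := 1 / (t + 1) with hη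
  have hη0 : 0 < η := by positivity
  have hηt : η * t ≤ 1 := by
    rw [hη, one_div_mul_eq_div, div_le_one (by positivity)]
    linarith
  set H : Set ℕ := {n | ∀ g ∈ insert g₀ S, ‖g (e n)‖ ≤ η * w n} with hH
  have hHheavy : ¬ LightSet w H := fun hl => by
    refine hheavy ((hl.union (LightSet.biUnion (hSfin.insert g₀)
      fun g _ => hsmall g η hη0)).mono fun n _ => ?_)
    by_cases hn : n ∈ H
    · exact Or.inl hn
    · simp only [hH, Set.mem_ofPred_eq, not_forall, not_le] at hn
      obtain ⟨g, hg, hlt⟩ := hn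
      exact Or.inr (Set.mem_biUnion hg hlt)
  obtain ⟨F, hFH, hFd, hFw⟩ := exists_disjoint_heavy_of_not_light hw hHheavy (Q ∪ A) t
  obtain ⟨E, n, hEF, hnE, hEt, htE⟩ := exists_subset_weight_crossing ht0 F hFw
  have hG : ∀ i ∈ insert n E, ∀ g ∈ insert g₀ S, ‖g (e i)‖ ≤ η * w i :=
    fun i hi => hFH (hEF hi)
  have hdQA : Disjoint (insert n E) (Q ∪ A) := hFd.mono_left hEF
  have hdA : Disjoint A (insert n E) := (hdQA.mono_right Finset.subset_union_right).symm
  have hdQ : Disjoint E Q :=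
    (hdQA.mono_right Finset.subset_union_left).mono_left (Finset.subset_insert _ _)
  have hsumE : ∀ g ∈ insert g₀ S, ∑ i ∈ E, ‖g (e i)‖ ≤ 1 := fun g hg =>
    calc ∑ i ∈ E, ‖g (e i)‖ ≤ ∑ i ∈ E, η * w i :=
          Finset.sum_le_sum fun i hi => hG i (Finset.mem_insert_of_mem hi) g hg
      _ = η * ∑ i ∈ E, w i := by rw [Finset.mul_sum]
      _ ≤ η * t := by gcongr
      _ ≤ 1 := hηt
  have hone : ‖∑ i ∈ E, (1 : 𝕜) • e i‖ ≤ 3 * D + 1 := by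
    obtain ⟨v, hv, hvD⟩ := habs E (fun _ => 1) hdQ (by simp) (hEt.trans hwA)
    set z := ∑ i ∈ E, (1 : 𝕜) • e i with hz
    obtain ⟨g, hg, hgz⟩ := exists_dual_vector'' 𝕜 z
    obtain ⟨g', hg', hnear⟩ := hSnet g hg
    have hgv : ‖(g - g') v‖ ≤ D := by
      rw [hB.eq_sum_of_coord_eq_zero hv, map_sum]
      calc ‖∑ i ∈ Q, (g - g') (f i v • e i)‖ ≤ ∑ i ∈ Q, cF * D * δ :=
            norm_sum_le_of_le _ fun i hi => by
              have h1 := hF i (z + v)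
              rw [map_add, hz, hB.coord_sum, if_neg (Finset.disjoint_right.1 hdQ hi),
                zero_add, ← hz] at h1
              rw [map_smul, norm_smul]
              exact mul_le_mul (h1.trans (mul_le_mul_of_nonneg_left hvD hcF.le)) (hnear i hi)
                (norm_nonneg _) (by positivity)
        _ = Q.card / (Q.card + 1) * D := by
            rw [Finset.sum_const, nsmul_eq_mul, hδ]
            field_simp
        _ ≤ 1 * D := by
            gcongr
            rw [div_le_one (by positivity)]
            linarith
        _ = D := one_mul D
    have hgzv : ‖(g - g') (z + v)‖ ≤ 2 * D :=
      ((g - g').le_of_opNorm_le ((norm_sub_le _ _).trans (by linarith [hS1 g' hg'])) _).trans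
        (mul_le_mul_of_nonneg_left hvD zero_le_two)
    have hg'z : ‖g' z‖ ≤ 1 := by
      rw [hz, map_sum]
      refine (norm_sum_le _ _).trans ?_
      simpa using hsumE g' (Set.mem_insert_of_mem _ hg')
    calc ‖z‖ = ‖g z‖ := by rw [hgz]; simp
      _ = ‖(g - g') (z + v) - (g - g') v + g' z‖ := by
          congr 1
          simp only [map_add, sub_apply]
          ring
      _ ≤ ‖(g - g') (z + v)‖ + ‖(g - g') v‖ + ‖g' z‖ :=
          (norm_add_le _ _).trans (add_le_add_left (norm_sub_le _ _) _)
      _ ≤ 3 * D + 1 := by linarith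
  obtain ⟨y, hy, hyle⟩ := absorbs_of_unimodular hB hw hs hASG (insert n E) (ε := fun _ => 1)
    (by simp) A a hdA ha htE.le
  rw [← hu] at hyle
  have hinsert : ‖∑ i ∈ insert n E, (1 : 𝕜) • e i‖ ≤ (3 + cE) * (D + 1) := by
    rw [Finset.sum_insert hnE, one_smul]
    refine (norm_add_le _ _).trans ?_
    nlinarith [hE n]
  have hg₀y : ‖g₀ y‖ ≤ cF * ‖u + y‖ * (1 + cE) := by
    calc ‖g₀ y‖ = ‖∑ i ∈ insert n E, g₀ (f i y • e i)‖ := by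
          rw [← map_sum, ← hB.eq_sum_of_coord_eq_zero hy]
      _ ≤ ∑ i ∈ insert n E, cF * ‖u + y‖ * ‖g₀ (e i)‖ :=
          norm_sum_le_of_le _ fun i hi => by
            have h1 := hF i (u + y)
            rw [map_add, hu, hB.coord_sum, if_neg (Finset.disjoint_right.1 hdA hi),
              zero_add, ← hu] at h1
            rw [map_smul, norm_smul]
            exact mul_le_mul_of_nonneg_right h1 (norm_nonneg _)
      _ = cF * ‖u + y‖ * (‖g₀ (e n)‖ + ∑ i ∈ E, ‖g₀ (e i)‖) := by
          rw [← Finset.mul_sum, Finset.sum_insert hnE]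
      _ ≤ _ := by
          have h1 : ‖g₀ (e n)‖ ≤ cE :=
            (g₀.le_of_opNorm_le hg₀ _).trans (by rw [one_mul]; exact hE n)
          have h2 := hsumE g₀ (Set.mem_insert _ _)
          rw [add_comm 1 cE]
          gcongr
  have hg₀uy : ‖g₀ (u + y)‖ ≤ ‖u + y‖ := (g₀.le_of_opNorm_le hg₀ _).trans_eq (one_mul _)
  calc ‖u‖ = ‖g₀ u‖ := by rw [hg₀u]; simp
    _ = ‖g₀ (u + y) - g₀ y‖ := by rw [map_add, add_sub_cancel_right]
    _ ≤ ‖u + y‖ + cF * ‖u + y‖ * (1 + cE) :=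
        (norm_sub_le _ _).trans (add_le_add hg₀uy hg₀y)
    _ = (1 + cF * (1 + cE)) * ‖u + y‖ := by ring
    _ ≤ (1 + cF * (1 + cE)) * (2 * K / s * ((3 + cE) * (D + 1))) := by
        gcongr
        exact hyle.trans (by gcongr)
    _ = _ := by ring

lemma exists_norm_le_of_absorbs [CompleteSpace X] {K s : ℝ} (hB : IsMarkushevichBasis e f)
    (hw : ∀ i, 0 < w i) (hs : 0 < s) (hK : 0 < K) (hASG : AlmostSemiGreedy e f w K s) :
    ∃ C, 0 < C ∧ ∀ Q b D, Absorbs e f w Q b D → ∀ (A : Finset ℕ) (a : ℕ → 𝕜),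
      (∀ i ∈ A, ‖a i‖ ≤ 1) → ∑ i ∈ A, w i ≤ b → ‖∑ i ∈ A, a i • e i‖ ≤ C * (D + 1) := by
  have hnn : ∀ {Q : Finset ℕ} {b D : ℝ}, Absorbs e f w Q b D → ∀ {A : Finset ℕ},
      ∑ i ∈ A, w i ≤ b → 0 ≤ D := fun h A hA =>
    h.nonneg ((Finset.sum_nonneg fun i _ => (hw i).le).trans hA)
  obtain ⟨M, hM, hlin⟩ := exists_linear_bound hB hw hs hASG
  by_cases hlight : LightSet w Set.univ
  · obtain ⟨T, hT⟩ := hlight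
    have hT0 : 0 ≤ T := by simpa using hT ∅ (by simp)
    refine ⟨M * (1 + T), by positivity, fun Q b D h A a ha hA => (hlin A a ha).trans ?_⟩
    have hD := hnn h hA
    calc M * (1 + ∑ i ∈ A, w i) ≤ M * (1 + T) * 1 := by
          rw [mul_one]; gcongr; exact hT A (Set.subset_univ _)
      _ ≤ _ := by gcongr; linarith
  by_cases hsmall : ∀ (g : X →L[𝕜] 𝕜) (η : ℝ), 0 < η → LightSet w {n | η * w n < ‖g (e n)‖}
  · exact exists_norm_le_of_absorbs_of_small hB hw hs hK hASG hlight hsmall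
  push Not at hsmall
  obtain ⟨g, η, hη, hH⟩ := hsmall
  obtain ⟨C, hC, hle⟩ := exists_weight_le_of_absorbs hB hw g hη hH
  refine ⟨M * (1 + C), by positivity, fun Q b D h A a ha hA => (hlin A a ha).trans ?_⟩
  have hD := hnn h hA
  rw [mul_assoc]
  gcongr
  nlinarith [hle Q b D ((Finset.sum_nonneg fun i _ => (hw i).le).trans hA) h]

lemma exists_superDemocratic [CompleteSpace X] {K s : ℝ} (hB : IsMarkushevichBasis e f)
    (hw : ∀ i, 0 < w i) (hs : 0 < s) (hK : 0 < K) (hASG : AlmostSemiGreedy e f w K s) :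
    ∃ C, 0 < C ∧ SuperDemocratic e f w C := by
  obtain ⟨C, hC, hle⟩ := exists_norm_le_of_absorbs hB hw hs hK hASG
  obtain ⟨cF, hcF, hF⟩ := hB.exists_bound_functionals
  refine ⟨C * (2 * K / s + cF), by positivity, fun A B ε ε' hε hε' hAB => ?_⟩
  rw [wsum_le_wsum_iff hw] at hAB
  rcases B.eq_empty_or_nonempty with rfl | ⟨j, hj⟩
  · rw [Finset.sum_empty] at hAB
    simp [eq_empty_of_sum_weight_nonpos hw hAB]
  have h := hle _ _ _ (absorbs_of_unimodular hB hw hs hASG B hε') A ε (fun i hi => (hε i hi).le) hAB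
  have h1 := hF j (∑ i ∈ B, ε' i • e i)
  rw [hB.coord_sum, if_pos hj, hε' j hj] at h1
  refine h.trans ?_
  rw [mul_assoc, add_mul]
  gcongr

lemma exists_truncationQuasiGreedy [CompleteSpace X] {K s : ℝ} (hB : IsMarkushevichBasis e f)
    (hw : ∀ i, 0 < w i) (hs : 0 < s) (hs1 : s ≤ 1) (hK : 0 < K)
    (hASG : AlmostSemiGreedy e f w K s) : ∃ C, 0 < C ∧ TruncationQuasiGreedy e f C := by
  obtain ⟨C, hC, hle⟩ := exists_norm_le_of_absorbs hB hw hs hK hASG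
  obtain ⟨cF, hcF, hF⟩ := hB.exists_bound_functionals
  refine ⟨C * (8 * K / s ^ 2 + cF), by positivity, fun x m A hA _ => ?_⟩
  set α := A.inf' hA fun i => ‖f i x‖ with hα
  have hαle : ∀ i ∈ A, α ≤ ‖f i x‖ := fun i hi => Finset.inf'_le _ hi
  have hα0 : 0 ≤ α := Finset.le_inf' hA _ fun i _ => norm_nonneg _
  rcases hα0.eq_or_lt with h0 | hpos
  · rw [← h0, zero_mul]
    positivity
  have hαx : α ≤ cF * ‖x‖ := by
    obtain ⟨i, hi⟩ := hA
    exact (hαle i hi).trans (hF i x)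
  obtain ⟨x', Q, hx', hQ⟩ := hB.exists_finite_support_near x (δ := α / (2 * cF)) (by positivity)
  have hclose : cF * ‖x - x'‖ ≤ α / 2 := by
    have := mul_le_mul_of_nonneg_left hx'.le hcF.le
    refine this.trans_eq ?_
    field_simp
  have hlarge : ∀ i ∈ A, α / 2 ≤ ‖f i x'‖ := fun i hi => by
    have h1 := (hF i (x - x')).trans hclose
    rw [map_sub] at h1
    linarith [norm_sub_norm_le (f i x) (f i x'), hαle i hi]
  have hx'x : ‖x'‖ ≤ 2 * ‖x‖ := by
    have h1 : ‖x - x'‖ ≤ ‖x‖ := by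
      refine le_of_mul_le_mul_left (hclose.trans ?_) hcF
      linarith
    have h2 := norm_sub_norm_le x' x
    rw [norm_sub_rev] at h2
    linarith
  have h := hle _ _ _
    (absorbs_of_large_coord hB hw hs hs1 hASG (half_pos hpos) hQ hlarge) A
    (fun i => sgn (f i x)) (fun i _ => (norm_sgn _).le) le_rfl
  calc α * ‖∑ i ∈ A, sgn (f i x) • e i‖
      ≤ α * (C * (2 * K / (s ^ 2 * (α / 2)) * (2 * ‖x‖) + 1)) := by
        gcongr
        exact h.trans (by gcongr)
    _ = C * (8 * K / s ^ 2 * ‖x‖ + α) := by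
        field_simp
        ring
    _ ≤ C * (8 * K / s ^ 2 * ‖x‖ + cF * ‖x‖) := by gcongr
    _ = _ := by ring

end Recovery

/-- characterizations of weak weight-almost semi-greedy bases. -/
theorem statement6 {𝕜 : Type*} [RCLike 𝕜] {X : Type*} [NormedAddCommGroup X]
    [NormedSpace 𝕜 X] [CompleteSpace X]
    (e : ℕ → X) (f : ℕ → X →L[𝕜] 𝕜) (hbasis : IsMarkushevichBasis e f)
    (w : ℕ → ℝ) (hw : ∀ i, 0 < w i) :
    List.TFAE
      [(∃ K : ℝ, 0 < K ∧ TruncationQuasiGreedy e f K) ∧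
         (∃ K : ℝ, 0 < K ∧ SuperDemocratic e f w K),
       (∃ K : ℝ, 0 < K ∧ TruncationQuasiGreedy e f K) ∧
         (∃ K : ℝ, 0 < K ∧ Democratic e f w K),
       ∀ s : ℝ, 0 < s → s ≤ 1 → ∃ K : ℝ, 0 < K ∧ AlmostSemiGreedy e f w K s,
       ∃ s K : ℝ, 0 < s ∧ s ≤ 1 ∧ 0 < K ∧ AlmostSemiGreedy e f w K s,
       ∀ s : ℝ, 0 < s → s ≤ 1 → ∃ K : ℝ, 0 < K ∧
         ∀ (x : X) (B : Finset ℕ),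
           (∃ (m : ℕ) (A : Finset ℕ), GreedySet f x m s A ∧ Disjoint A B ∧
             wsum w (B : Set ℕ) ≤ wsum w (A : Set ℕ)) →
           ‖x‖ ≤ K * ‖x - proj e f B x‖] := by
  tfae_have 1 → 2 := by
    rintro ⟨hT, K, hK, hS⟩
    exact ⟨hT, K, hK, fun A B hAB => by
      simpa using hS A B (fun _ => 1) (fun _ => 1) (by simp) (by simp) hAB⟩
  tfae_have 2 → 5 := by
    rintro ⟨⟨K, hK, hT⟩, L, hL, hD⟩ s hs hs1
    refine ⟨1 + 16 * K ^ 3 * L / s, by positivity, fun x B => ?_⟩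
    rintro ⟨m, A, hA, hd, hBA⟩
    exact norm_le_of_disjoint_weakGreedySet hbasis hw hK hL hs hT hD hA hd hBA
  tfae_have 5 → 3 := by
    intro h s hs hs1
    obtain ⟨K, hK, h⟩ := h s hs hs1
    exact ⟨K, hK, almostSemiGreedy_of_disjoint_bound hbasis hw hs1 h⟩
  tfae_have 3 → 4 := by
    intro h
    obtain ⟨K, hK, h⟩ := h 1 one_pos le_rfl
    exact ⟨1, K, one_pos, le_rfl, hK, h⟩
  tfae_have 4 → 1 := by
    rintro ⟨s, K, hs, hs1, hK, h⟩
    exact ⟨exists_truncationQuasiGreedy hbasis hw hs hs1 hK h,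
      exists_superDemocratic hbasis hw hs hK h⟩
  tfae_finish

end GreedyPaper
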